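/- There exists an orthonormal basis U, V, T of Π with respect to ⟨·,·⟩ such that U_AC = (0,0), V_BD = (0,0), T_AC·V_AC = 0 and T_BD·U_BD = 0, and such that moreover: if m_A = m_C or m_B = m_D then U and V both have scale 0 (i.e. are at infinity), while if m_A ≠ m_C and m_B ≠ m_D then U and V both have nonzero scale. -/

import Mathlib

noncomputable section

open Real Set

/-- Membership predicate for conformally inscribed parallelograms.
Coordinates of `P : Fin 9 → ℝ`:
`0 = x_A, 1 = y_A, 2 = x_B, 3 = y_B, 4 = x_C, 5 = y_C, 6 = x_D, 7 = y_D, 8 = w`.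
The vertex `(x_L, y_L)` lies on the line `L(w)` for `L ∈ {A,B,C,D}` and the
midpoints of the two diagonals coincide. -/
def IsCIP (mA mB mC mD bA : ℝ) (P : Fin 9 → ℝ) : Prop :=
  P 1 = mA * P 0 + bA * P 8 ∧
  P 3 = mB * P 2 + P 8 ∧
  P 5 = mC * P 4 ∧
  P 7 = mD * P 6 ∧
  P 0 + P 4 = P 2 + P 6 ∧
  P 1 + P 5 = P 3 + P 7

/-- `Π`, the set of conformally inscribed parallelograms. -/
def CIP (mA mB mC mD bA : ℝ) : Set (Fin 9 → ℝ) := {P | IsCIP mA mB mC mD bA P}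

/-- The `AC` diagonal vector of a parallelogram. -/
def vAC (P : Fin 9 → ℝ) : ℝ × ℝ := (P 0 - P 4, P 1 - P 5)

/-- The `BD` diagonal vector of a parallelogram. -/
def vBD (P : Fin 9 → ℝ) : ℝ × ℝ := (P 2 - P 6, P 3 - P 7)

/-- The `AB` side vector of a parallelogram. -/
def vAB (P : Fin 9 → ℝ) : ℝ × ℝ := (P 0 - P 2, P 1 - P 3)

/-- The `BC` side vector of a parallelogram. -/
def vBC (P : Fin 9 → ℝ) : ℝ × ℝ := (P 2 - P 4, P 3 - P 5)

/-- Dot product in `ℝ²`. -/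
def dot2 (a b : ℝ × ℝ) : ℝ := a.1 * b.1 + a.2 * b.2

/-- The inner product `⟨P, Q⟩ = P_AC · Q_AC + P_BD · Q_BD` on `Π`. -/
def pinner (P Q : Fin 9 → ℝ) : ℝ := dot2 (vAC P) (vAC Q) + dot2 (vBD P) (vBD Q)

/-- The set `CIP mA mB mC mD bA` as a linear subspace. -/
def cipSubmodule (mA mB mC mD bA : ℝ) : Submodule ℝ (Fin 9 → ℝ) where
  carrier := CIP mA mB mC mD bA
  zero_mem' := by simp [CIP, IsCIP]
  add_mem' := by
    rintro P Q ⟨h1, h2, h3, h4, h5, h6⟩ ⟨k1, k2, k3, k4, k5, k6⟩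
    refine ⟨?_, ?_, ?_, ?_, ?_, ?_⟩ <;> simp only [Pi.add_apply] <;> linarith
  smul_mem' := by
    rintro c P ⟨h1, h2, h3, h4, h5, h6⟩
    refine ⟨?_, ?_, ?_, ?_, ?_, ?_⟩ <;> simp only [Pi.smul_apply, smul_eq_mul]
    · rw [h1]; ring
    · rw [h2]; ring
    · rw [h3]; ring
    · rw [h4]; ring
    · linear_combination c * h5
    · linear_combination c * h6

/-- A parallelogram is determined by `x_A`, `x_B` and its scale. -/
def cipCoord (mA mB mC mD bA : ℝ) : cipSubmodule mA mB mC mD bA →ₗ[ℝ] (Fin 3 → ℝ) where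
  toFun P := ![P.1 0, P.1 2, P.1 8]
  map_add' P Q := by ext i; fin_cases i <;> simp
  map_smul' c P := by ext i; fin_cases i <;> simp

theorem cipCoord_injective {mA mB mC mD : ℝ} (bA : ℝ) (hCD : mC ≠ mD) :
    Function.Injective (cipCoord mA mB mC mD bA) := by
  rw [injective_iff_map_eq_zero]
  rintro ⟨P, h1, h2, h3, h4, h5, h6⟩ h
  have e0 : P 0 = 0 := congrFun h 0
  have e2 : P 2 = 0 := congrFun h 1
  have e8 : P 8 = 0 := congrFun h 2
  have e4 : P 4 = 0 := by
    apply (mul_eq_zero.1 _).resolve_left (sub_ne_zero.2 hCD)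
    rw [h1, h2, h3, h4, e0, e2, e8] at h6
    rw [e0, e2] at h5
    linear_combination h6 - mD * h5
  have e6 : P 6 = 0 := by linarith
  simp only [e0, e2, e4, e6, e8, mul_zero, add_zero] at h1 h2 h3 h4
  ext i
  fin_cases i <;> simp [*]

theorem cipCoord_surjective {mA mB mC mD : ℝ} (bA : ℝ) (hCD : mC ≠ mD) :
    Function.Surjective (cipCoord mA mB mC mD bA) := by
  intro v
  have hne : mC - mD ≠ 0 := sub_ne_zero.2 hCD
  let xC := ((mB - mD) * v 1 + v 2 - bA * v 2 - (mA - mD) * v 0) / (mC - mD)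
  have hx : xC * (mC - mD) = (mB - mD) * v 1 + v 2 - bA * v 2 - (mA - mD) * v 0 :=
    div_mul_cancel₀ _ hne
  let P : Fin 9 → ℝ := ![v 0, mA * v 0 + bA * v 2, v 1, mB * v 1 + v 2, xC, mC * xC,
    v 0 + xC - v 1, mD * (v 0 + xC - v 1), v 2]
  have hP : P ∈ cipSubmodule mA mB mC mD bA := by
    refine ⟨rfl, rfl, rfl, rfl, ?_, ?_⟩
    · change v 0 + xC = v 1 + (v 0 + xC - v 1)
      ring
    · change mA * v 0 + bA * v 2 + mC * xC = mB * v 1 + v 2 + mD * (v 0 + xC - v 1)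
      linear_combination hx
  refine ⟨⟨P, hP⟩, ?_⟩
  ext i
  fin_cases i <;> rfl

theorem finrank_cipSubmodule {mA mB mC mD : ℝ} (bA : ℝ) (hCD : mC ≠ mD) :
    Module.finrank ℝ (cipSubmodule mA mB mC mD bA) = 3 := by
  simpa using (LinearEquiv.ofBijective (cipCoord mA mB mC mD bA)
    ⟨cipCoord_injective bA hCD, cipCoord_surjective bA hCD⟩).finrank_eq

/-- The pair of diagonal vectors of a parallelogram, as a vector of Euclidean 4-space. -/
def diagonals (mA mB mC mD bA : ℝ) :
    cipSubmodule mA mB mC mD bA →ₗ[ℝ] EuclideanSpace ℝ (Fin 4) where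
  toFun P := !₂[P.1 0 - P.1 4, P.1 1 - P.1 5, P.1 2 - P.1 6, P.1 3 - P.1 7]
  map_add' P Q := by ext i; fin_cases i <;> simp <;> ring
  map_smul' c P := by ext i; fin_cases i <;> simp <;> ring

theorem inner_diagonals {mA mB mC mD bA : ℝ} (P Q : cipSubmodule mA mB mC mD bA) :
    inner ℝ (diagonals mA mB mC mD bA P) (diagonals mA mB mC mD bA Q) = pinner P.1 Q.1 := by
  simp [diagonals, pinner, dot2, vAC, vBD, PiLp.inner_apply, Fin.sum_univ_four]
  ring

theorem eq_zero_of_vAC_of_vBD {mA mB mC mD bA : ℝ} (hCD : mC ≠ mD) {P : Fin 9 → ℝ}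
    (hP : P ∈ CIP mA mB mC mD bA) (hAC : vAC P = (0, 0)) (hBD : vBD P = (0, 0)) : P = 0 := by
  obtain ⟨h1, h2, h3, h4, h5, h6⟩ := hP
  simp only [vAC, vBD, Prod.mk.injEq] at hAC hBD
  obtain ⟨a1, a2⟩ := hAC
  obtain ⟨b1, b2⟩ := hBD
  have e46 : P 4 = P 6 := by linarith
  have e4 : P 4 = 0 := by
    apply (mul_eq_zero.1 _).resolve_left (sub_ne_zero.2 hCD)
    have e57 : P 5 = P 7 := by linarith
    rw [h3, h4, ← e46] at e57
    linear_combination e57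
  have e0 : P 0 = 0 := by linarith
  have e2 : P 2 = 0 := by linarith
  have e6 : P 6 = 0 := by linarith
  have e5 : P 5 = 0 := by rw [h3, e4, mul_zero]
  have e7 : P 7 = 0 := by rw [h4, e6, mul_zero]
  have e1 : P 1 = 0 := by linarith
  have e3 : P 3 = 0 := by linarith
  have e8 : P 8 = 0 := by rw [e3, e2] at h2; linarith
  ext i
  fin_cases i <;> assumption

theorem diagonals_injective {mA mB mC mD : ℝ} (bA : ℝ) (hCD : mC ≠ mD) :
    Function.Injective (diagonals mA mB mC mD bA) := by
  rw [injective_iff_map_eq_zero]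
  rintro ⟨P, hP⟩ h
  have hc : ∀ i, diagonals mA mB mC mD bA ⟨P, hP⟩ i = 0 := fun i ↦ by rw [h]; rfl
  exact Subtype.ext (eq_zero_of_vAC_of_vBD hCD hP (Prod.ext (hc 0) (hc 1))
    (Prod.ext (hc 2) (hc 3)))

theorem exists_vAC_eq_zero (mA mB mC mD bA : ℝ) :
    ∃ P ∈ CIP mA mB mC mD bA, P ≠ 0 ∧ vAC P = (0, 0) ∧
      ((mA = mC ∨ mB = mD) → P 8 = 0) ∧ ((mA ≠ mC ∧ mB ≠ mD) → P 8 ≠ 0) := by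
  have key : ∀ p d w : ℝ, (mC - mA) * p = bA * w →
      (mB - mC) * p + mB * d + w = (mC - mD) * p + mD * d → (p ≠ 0 ∨ d ≠ 0) →
      ∃ P ∈ CIP mA mB mC mD bA, P ≠ 0 ∧ vAC P = (0, 0) ∧ P 8 = w := by
    intro p d w hA hB hne
    refine ⟨![p, mC * p, p + d, mB * (p + d) + w, p, mC * p, p - d, mD * (p - d), w],
      ⟨?_, rfl, rfl, rfl, ?_, ?_⟩, ?_, ?_, rfl⟩
    · change mC * p = mA * p + bA * w
      linear_combination hA
    · change p + p = (p + d) + (p - d)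
      ring
    · change mC * p + mC * p = mB * (p + d) + w + mD * (p - d)
      linear_combination -hB
    · intro h
      have hp : p = 0 := congrFun h 0
      have hd : p + d = 0 := congrFun h 2
      rcases hne with h' | h'
      · exact h' hp
      · exact h' (by linarith)
    · exact Prod.ext (sub_self p) (sub_self (mC * p))
  by_cases hB : mB = mD
  · obtain ⟨P, hP, h0, hAC, h8⟩ := key 0 1 0 (by ring) (by rw [hB]; ring) (Or.inr one_ne_zero)
    exact ⟨P, hP, h0, hAC, fun _ ↦ h8, fun h ↦ absurd hB h.2⟩
  have hB' : mB - mD ≠ 0 := sub_ne_zero.2 hB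
  by_cases hA : mA = mC
  · obtain ⟨P, hP, h0, hAC, h8⟩ := key (mB - mD) (2 * mC - mB - mD) 0 (by rw [hA]; ring)
      (by ring) (Or.inl hB')
    exact ⟨P, hP, h0, hAC, fun _ ↦ h8, fun h ↦ absurd hA h.1⟩
  have hA' : mC - mA ≠ 0 := sub_ne_zero.2 (Ne.symm hA)
  have hw : (mC - mA) * (mB - mD) ≠ 0 := mul_ne_zero hA' hB'
  obtain ⟨P, hP, h0, hAC, h8⟩ := key (bA * (mB - mD))
    ((mC - mD) * bA - (mB - mC) * bA - (mC - mA)) ((mC - mA) * (mB - mD)) (by ring) (by ring)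
    (by
      by_contra! h
      have hb : bA = 0 := (mul_eq_zero.1 h.1).resolve_right hB'
      rw [hb] at h
      exact hA' (by linarith [h.2]))
  exact ⟨P, hP, h0, hAC, fun h ↦ absurd h (by tauto), fun _ ↦ h8 ▸ hw⟩

theorem exists_vBD_eq_zero (mA mB mC mD bA : ℝ) :
    ∃ P ∈ CIP mA mB mC mD bA, P ≠ 0 ∧ vBD P = (0, 0) ∧
      ((mA = mC ∨ mB = mD) → P 8 = 0) ∧ ((mA ≠ mC ∧ mB ≠ mD) → P 8 ≠ 0) := by
  have key : ∀ p c : ℝ,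
      (mA - mC) * c = (2 * mD - mC - mA - bA * (mD - mB)) * p → (p ≠ 0 ∨ c ≠ 0) →
      ∃ P ∈ CIP mA mB mC mD bA, P ≠ 0 ∧ vBD P = (0, 0) ∧ P 8 = (mD - mB) * p := by
    intro p c h hne
    refine ⟨![p + c, mA * (p + c) + bA * ((mD - mB) * p), p, mD * p, p - c, mC * (p - c), p,
      mD * p, (mD - mB) * p], ⟨rfl, ?_, rfl, rfl, ?_, ?_⟩, ?_, ?_, rfl⟩
    · change mD * p = mB * p + (mD - mB) * p
      ring
    · change (p + c) + (p - c) = p + p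
      ring
    · change mA * (p + c) + bA * ((mD - mB) * p) + mC * (p - c) = mD * p + mD * p
      linear_combination h
    · intro h
      have hc : p + c = 0 := congrFun h 0
      have hp : p = 0 := congrFun h 2
      rcases hne with h' | h'
      · exact h' hp
      · exact h' (by linarith)
    · exact Prod.ext (sub_self p) (sub_self (mD * p))
  by_cases hA : mA = mC
  · obtain ⟨P, hP, h0, hBD, h8⟩ := key 0 1 (by rw [hA]; ring) (Or.inr one_ne_zero)
    exact ⟨P, hP, h0, hBD, fun _ ↦ by rw [h8, mul_zero], fun h ↦ absurd hA h.1⟩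
  have hA' : mA - mC ≠ 0 := sub_ne_zero.2 hA
  obtain ⟨P, hP, h0, hBD, h8⟩ := key (mA - mC) (2 * mD - mC - mA - bA * (mD - mB)) (by ring)
    (Or.inl hA')
  refine ⟨P, hP, h0, hBD, fun h ↦ ?_, fun h ↦ ?_⟩
  · rw [h8, h.resolve_left hA, sub_self, zero_mul]
  · rw [h8]
    exact mul_ne_zero (sub_ne_zero.2 (Ne.symm h.2)) hA'

theorem pinner_smul_smul (a b : ℝ) (P Q : Fin 9 → ℝ) :
    pinner (a • P) (b • Q) = a * b * pinner P Q := by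
  simp only [pinner, dot2, vAC, vBD, Pi.smul_apply, smul_eq_mul]
  ring

theorem vAC_smul (c : ℝ) (P : Fin 9 → ℝ) : vAC (c • P) = c • vAC P := by
  simp [vAC, mul_sub]

theorem vBD_smul (c : ℝ) (P : Fin 9 → ℝ) : vBD (c • P) = c • vBD P := by
  simp [vBD, mul_sub]

theorem exists_smul_pinner_self_eq_one {mA mB mC mD bA : ℝ} (hCD : mC ≠ mD) {P : Fin 9 → ℝ}
    (hP : P ∈ CIP mA mB mC mD bA) (h0 : P ≠ 0) :
    ∃ c : ℝ, c ≠ 0 ∧ pinner (c • P) (c • P) = 1 := by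
  have hpos : 0 < pinner P P := by
    rw [← inner_diagonals (⟨P, hP⟩ : cipSubmodule mA mB mC mD bA) ⟨P, hP⟩, real_inner_self_pos,
      Ne, map_eq_zero_iff _ (diagonals_injective bA hCD)]
    exact fun h ↦ h0 (congrArg Subtype.val h)
  have hs : √(pinner P P) ≠ 0 := (Real.sqrt_pos.2 hpos).ne'
  refine ⟨(√(pinner P P))⁻¹, inv_ne_zero hs, ?_⟩
  rw [pinner_smul_smul, ← mul_inv, Real.mul_self_sqrt hpos.le, inv_mul_cancel₀ hpos.ne']

/-- An orthonormal pair of parallelograms extends to an orthonormal basis. -/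
theorem exists_orthonormal_completion {mA mB mC mD bA : ℝ} (hCD : mC ≠ mD) {U V : Fin 9 → ℝ}
    (hU : U ∈ CIP mA mB mC mD bA) (hV : V ∈ CIP mA mB mC mD bA)
    (hUU : pinner U U = 1) (hVV : pinner V V = 1) (hUV : pinner U V = 0) :
    ∃ T ∈ CIP mA mB mC mD bA, pinner T T = 1 ∧ pinner U T = 0 ∧ pinner V T = 0 ∧
      ∀ P ∈ CIP mA mB mC mD bA, ∃ u v t : ℝ, P = u • U + v • V + t • T := by
  let e := LinearEquiv.ofInjective (diagonals mA mB mC mD bA) (diagonals_injective bA hCD)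
  have he : ∀ P Q, inner ℝ (e P) (e Q) = pinner P.1 Q.1 := fun P Q ↦ inner_diagonals P Q
  let U' : cipSubmodule mA mB mC mD bA := ⟨U, hU⟩
  let V' : cipSubmodule mA mB mC mD bA := ⟨V, hV⟩
  have hcard : Module.finrank ℝ (LinearMap.range (diagonals mA mB mC mD bA)) =
      Fintype.card (Fin 3) := by
    rw [← e.finrank_eq, finrank_cipSubmodule bA hCD, Fintype.card_fin]
  have hVU : pinner V U = 0 := by
    rw [← he V' U', real_inner_comm, he]
    exact hUV
  have hort : Orthonormal ℝ (({0, 1} : Set (Fin 3)).domRestrict ![e U', e V', 0]) := by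
    rw [orthonormal_iff_ite]
    rintro ⟨i, rfl | rfl⟩ ⟨j, rfl | rfl⟩
    · simpa using (he U' U').trans hUU
    · rw [if_neg (by simp [Subtype.ext_iff])]; exact (he U' V').trans hUV
    · rw [if_neg (by simp [Subtype.ext_iff])]; exact (he V' U').trans hVU
    · simpa using (he V' V').trans hVV
  obtain ⟨b, hb⟩ := hort.exists_orthonormalBasis_extension_of_card_eq hcard
  have hb0 : b 0 = e U' := hb 0 (by simp)
  have hb1 : b 1 = e V' := hb 1 (by simp)
  have hb2 : b 2 = e (e.symm (b 2)) := (e.apply_symm_apply _).symm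
  have hij := orthonormal_iff_ite.1 b.orthonormal
  refine ⟨(e.symm (b 2)).1, (e.symm (b 2)).2, ?_, ?_, ?_, fun P hP ↦ ?_⟩
  · rw [← he, ← hb2, hij]; simp
  · rw [← he U', ← hb2, ← hb0, hij]; simp
  · rw [← he V', ← hb2, ← hb1, hij]; simp
  · have hsum := b.sum_repr (e ⟨P, hP⟩)
    rw [Fin.sum_univ_three, hb0, hb1, hb2, ← map_smul, ← map_smul, ← map_smul, ← map_add,
      ← map_add] at hsum
    exact ⟨_, _, _, (congrArg Subtype.val (e.injective hsum)).symm⟩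

theorem stmt_4 (mA mB mC mD bA : ℝ) (hCD : mC ≠ mD) :
    ∃ U V T : Fin 9 → ℝ,
      U ∈ CIP mA mB mC mD bA ∧ V ∈ CIP mA mB mC mD bA ∧ T ∈ CIP mA mB mC mD bA ∧
      pinner U U = 1 ∧ pinner V V = 1 ∧ pinner T T = 1 ∧
      pinner U V = 0 ∧ pinner U T = 0 ∧ pinner V T = 0 ∧
      (∀ P ∈ CIP mA mB mC mD bA, ∃ u v t : ℝ, P = u • U + v • V + t • T) ∧
      vAC U = (0, 0) ∧ vBD V = (0, 0) ∧
      dot2 (vAC T) (vAC V) = 0 ∧ dot2 (vBD T) (vBD U) = 0 ∧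
      ((mA = mC ∨ mB = mD) → U 8 = 0 ∧ V 8 = 0) ∧
      ((mA ≠ mC ∧ mB ≠ mD) → U 8 ≠ 0 ∧ V 8 ≠ 0) := by
  obtain ⟨U, hU, hU0, hUAC, hUinf, hUfin⟩ := exists_vAC_eq_zero mA mB mC mD bA
  obtain ⟨V, hV, hV0, hVBD, hVinf, hVfin⟩ := exists_vBD_eq_zero mA mB mC mD bA
  obtain ⟨a, ha, hUU⟩ := exists_smul_pinner_self_eq_one hCD hU hU0
  obtain ⟨b, hb, hVV⟩ := exists_smul_pinner_self_eq_one hCD hV hV0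
  have hUV : pinner (a • U) (b • V) = 0 := by
    rw [pinner_smul_smul, pinner, hUAC, hVBD]
    simp [dot2]
  have haU : a • U ∈ CIP mA mB mC mD bA := (cipSubmodule mA mB mC mD bA).smul_mem a hU
  have hbV : b • V ∈ CIP mA mB mC mD bA := (cipSubmodule mA mB mC mD bA).smul_mem b hV
  have hUAC' : vAC (a • U) = (0, 0) := by simp [vAC_smul, hUAC]
  have hVBD' : vBD (b • V) = (0, 0) := by simp [vBD_smul, hVBD]
  obtain ⟨T, hT, hTT, hUT, hVT, hspan⟩ := exists_orthonormal_completion hCD haU hbV hUU hVV hUV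
  refine ⟨a • U, b • V, T, haU, hbV, hT, hUU, hVV, hTT, hUV, hUT, hVT, hspan, hUAC', hVBD',
    ?_, ?_, fun h ↦ ?_, fun h ↦ ?_⟩
  · rw [pinner, hVBD'] at hVT
    simp only [dot2, zero_mul, add_zero] at hVT ⊢
    linarith
  · rw [pinner, hUAC'] at hUT
    simp only [dot2, zero_mul, add_zero, zero_add] at hUT ⊢
    linarith
  · simp [hUinf h, hVinf h]
  · exact ⟨mul_ne_zero ha (hUfin h), mul_ne_zero hb (hVfin h)⟩
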